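/- arXiv:2210.04079 — 4 statements merged into one kernel-verified Lean document; each statement's English description precedes it below -/
import Mathlib

section
/- Let X₁, …, Xₙ be i.i.d. copies of X and let r ≥ 1, n ≥ 1. Define the random sampling probabilities πᵢ := w(Xᵢ) / Σ_{j=1}^n w(Xⱼ), where w(x) := (b''(xᵀβ₀))^{1/2} ‖LΦ⁻¹x‖ and w(X) > 0 almost surely. Assume E[w(X)] < ∞, E[b''(Xᵀβ₀)‖X‖²] < ∞ and E[b''(Xᵀβ₀)‖X‖² / w(X)] < ∞. Then E[ (1/n²) Σ_{i=1}^n b''(Xᵢᵀβ₀) Xᵢ Xᵢᵀ ( 1/(r πᵢ) − 1/r + 1 ) ] = (1/r)·((n−1)/n)·m·Λ + (1/n)·Φ, where m := E[w(X)] and Λ := E[ b''(Xᵀβ₀) X Xᵀ / w(X) ]. -/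
open MeasureTheory ProbabilityTheory Filter Matrix

noncomputable section

/-- Euclidean norm of a vector in `ℝ^p`. -/
def euclNorm {p : ℕ} (v : Fin p → ℝ) : ℝ := Real.sqrt (∑ i, v i ^ 2)

/-- For independent variables `X k` with the law of `X₀`, the mean of `g (X k) * w (X l)`
with `k ≠ l` factors. -/
lemma integrable_and_integral_mul_of_ne
    {Ω E ι : Type*} [MeasurableSpace Ω] [MeasurableSpace E] {μ : Measure Ω}
    {X : ι → Ω → E} {X₀ : Ω → E} (hindep : iIndepFun X μ)
    (hident : ∀ k, IdentDistrib (X k) X₀ μ μ) {g w : E → ℝ}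
    (hg : Measurable g) (hw : Measurable w)
    (hgint : Integrable (fun ω => g (X₀ ω)) μ) (hwint : Integrable (fun ω => w (X₀ ω)) μ)
    {k l : ι} (hkl : k ≠ l) :
    Integrable (fun ω => g (X k ω) * w (X l ω)) μ ∧
      ∫ ω, g (X k ω) * w (X l ω) ∂μ = (∫ ω, g (X₀ ω) ∂μ) * ∫ ω, w (X₀ ω) ∂μ := by
  have hgk : IdentDistrib (fun ω => g (X k ω)) (fun ω => g (X₀ ω)) μ μ := (hident k).comp hg
  have hwl : IdentDistrib (fun ω => w (X l ω)) (fun ω => w (X₀ ω)) μ μ := (hident l).comp hw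
  have hind : IndepFun (fun ω => g (X k ω)) (fun ω => w (X l ω)) μ :=
    (hindep.indepFun hkl).comp hg hw
  have hgk_int := hgk.integrable_iff.2 hgint
  have hwl_int := hwl.integrable_iff.2 hwint
  refine ⟨hind.integrable_mul hgk_int hwl_int, ?_⟩
  rw [hind.integral_fun_mul_eq_mul_integral hgk_int.aestronglyMeasurable
    hwl_int.aestronglyMeasurable, hgk.integral_eq, hwl.integral_eq]

/-- The mean of an importance-weighted sum whose sampling probabilities are proportional to
`w (X k)`. -/
lemma integral_sum_mul_inv_sampling_prob
    {Ω E ι : Type*} [MeasurableSpace Ω] [MeasurableSpace E] [Fintype ι] {μ : Measure Ω}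
    {X : ι → Ω → E} {X₀ : Ω → E} (hindep : iIndepFun X μ)
    (hident : ∀ k, IdentDistrib (X k) X₀ μ μ) {f w : E → ℝ}
    (hf : Measurable f) (hw : Measurable w) (hwpos : ∀ k, ∀ᵐ ω ∂μ, 0 < w (X k ω))
    (hfint : Integrable (fun ω => f (X₀ ω)) μ) (hwint : Integrable (fun ω => w (X₀ ω)) μ)
    (hfwint : Integrable (fun ω => f (X₀ ω) / w (X₀ ω)) μ) (r : ℝ) :
    ∫ ω, ∑ k, f (X k ω) * (1 / (r * (w (X k ω) / ∑ l, w (X l ω))) - 1 / r + 1) ∂μ =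
      Fintype.card ι * (1 / r * ((Fintype.card ι - 1) *
        ((∫ ω, f (X₀ ω) / w (X₀ ω) ∂μ) * ∫ ω, w (X₀ ω) ∂μ)) + ∫ ω, f (X₀ ω) ∂μ) := by
  classical
  have hcross {k l : ι} (hkl : k ≠ l) :=
    integrable_and_integral_mul_of_ne hindep hident (hf.div hw) hw hfwint hwint hkl
  simp only [Pi.div_apply] at hcross
  have hfk (k : ι) : IdentDistrib (fun ω => f (X k ω)) (fun ω => f (X₀ ω)) μ μ :=
    (hident k).comp hf
  have hfk_int (k : ι) := (hfk k).integrable_iff.2 hfint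
  have hsum_int (k : ι) : Integrable (fun ω => 1 / r *
      ∑ l ∈ Finset.univ.erase k, f (X k ω) / w (X k ω) * w (X l ω)) μ :=
    (integrable_finsetSum _ fun l hl => (hcross (Finset.ne_of_mem_erase hl).symm).1).const_mul _
  have hae : (fun ω => ∑ k, f (X k ω) * (1 / (r * (w (X k ω) / ∑ l, w (X l ω))) - 1 / r + 1))
      =ᵐ[μ] fun ω => ∑ k, (1 / r *
        ∑ l ∈ Finset.univ.erase k, f (X k ω) / w (X k ω) * w (X l ω) + f (X k ω)) := by
    filter_upwards [ae_all_iff.2 hwpos] with ω hω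
    refine Finset.sum_congr rfl fun k _ => ?_
    have hk := (hω k).ne'
    rw [← Finset.mul_sum, ← Finset.add_sum_erase _ _ (Finset.mem_univ k), one_div, mul_inv,
      inv_div]
    field_simp
    ring
  rw [integral_congr_ae hae, integral_finsetSum _ fun k _ => (hsum_int k).fun_add (hfk_int k)]
  have hterm (k : ι) : ∫ ω, (1 / r *
      ∑ l ∈ Finset.univ.erase k, f (X k ω) / w (X k ω) * w (X l ω) + f (X k ω)) ∂μ =
      1 / r * ((Fintype.card ι - 1) *
        ((∫ ω, f (X₀ ω) / w (X₀ ω) ∂μ) * ∫ ω, w (X₀ ω) ∂μ)) + ∫ ω, f (X₀ ω) ∂μ := by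
    rw [integral_add (hsum_int k) (hfk_int k), (hfk k).integral_eq, integral_const_mul,
      integral_finsetSum _ fun l hl => (hcross (Finset.ne_of_mem_erase hl).symm).1,
      Finset.sum_congr rfl fun l hl => (hcross (Finset.ne_of_mem_erase hl).symm).2,
      Finset.sum_const, Finset.card_erase_of_mem (Finset.mem_univ k), nsmul_eq_mul,
      Nat.cast_sub (Finset.card_pos.2 ⟨k, Finset.mem_univ k⟩), Finset.card_univ, Nat.cast_one]
  simp only [hterm, Finset.sum_const, Finset.card_univ, nsmul_eq_mul]

/-- Equation (weightedvariance): with the optimal subsampling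
probabilities `πᵢ = w(Xᵢ)/∑ⱼ w(Xⱼ)`, where `w(x) = (b''(xᵀβ₀))^{1/2}‖LΦ⁻¹x‖`,
one has, entrywise,
`E[(1/n²)∑ᵢ b''(Xᵢᵀβ₀)XᵢXᵢᵀ(1/(rπᵢ) − 1/r + 1)] = (1/r)((n−1)/n)·m·Λ + (1/n)·Φ`. -/
theorem weighted_score_variance
    {Ω : Type*} [MeasurableSpace Ω] (μ : Measure Ω) [IsProbabilityMeasure μ]
    {p n r : ℕ} (hn : 1 ≤ n) (hr : 1 ≤ r)
    (X : Fin n → Ω → Fin p → ℝ) (X₀ : Ω → Fin p → ℝ)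
    (hmeas : ∀ k, Measurable (X k)) (hX₀ : Measurable X₀)
    (hindep : iIndepFun X μ)
    (hident : ∀ k, IdentDistrib (X k) X₀ μ μ)
    (β₀ : Fin p → ℝ) (b'' : ℝ → ℝ)
    (hb_cont : Continuous b'') (hb_bdd : ∃ M, ∀ t, |b'' t| ≤ M)
    (hb_nonneg : ∀ t, 0 ≤ b'' t)
    (L Φ : Matrix (Fin p) (Fin p) ℝ)
    (hΦint : ∀ i j, Integrable (fun ω => b'' (X₀ ω ⬝ᵥ β₀) * (X₀ ω i * X₀ ω j)) μ)
    (hΦ : Φ = Matrix.of fun i j => ∫ ω, b'' (X₀ ω ⬝ᵥ β₀) * (X₀ ω i * X₀ ω j) ∂μ)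
    (hΦinv : IsUnit Φ.det)
    -- w(x) := (b''(xᵀβ₀))^{1/2} ‖LΦ⁻¹x‖, with w(X) > 0 a.s.
    (w : (Fin p → ℝ) → ℝ)
    (hw : ∀ x, w x = Real.sqrt (b'' (x ⬝ᵥ β₀)) * euclNorm ((L * Φ⁻¹).mulVec x))
    (hwpos : ∀ k, ∀ᵐ ω ∂μ, 0 < w (X k ω))
    (hwpos₀ : ∀ᵐ ω ∂μ, 0 < w (X₀ ω))
    -- moment conditions: E[w(X)] < ∞, E[b''(Xᵀβ₀)‖X‖²] < ∞, E[b''(Xᵀβ₀)‖X‖²/w(X)] < ∞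
    (hmint : Integrable (fun ω => w (X₀ ω)) μ)
    (hbX2int : Integrable (fun ω => b'' (X₀ ω ⬝ᵥ β₀) * euclNorm (X₀ ω) ^ 2) μ)
    (hbX2wint : Integrable (fun ω => b'' (X₀ ω ⬝ᵥ β₀) * euclNorm (X₀ ω) ^ 2 / w (X₀ ω)) μ)
    -- m := E[w(X)] and Λ := E[b''(Xᵀβ₀) X Xᵀ / w(X)]
    (m : ℝ) (hm : m = ∫ ω, w (X₀ ω) ∂μ)
    (Λ : Matrix (Fin p) (Fin p) ℝ)
    (hΛint : ∀ i j, Integrable (fun ω => b'' (X₀ ω ⬝ᵥ β₀) * (X₀ ω i * X₀ ω j) / w (X₀ ω)) μ)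
    (hΛ : Λ = Matrix.of fun i j => ∫ ω, b'' (X₀ ω ⬝ᵥ β₀) * (X₀ ω i * X₀ ω j) / w (X₀ ω) ∂μ) :
    ∀ i j,
      (∫ ω, (1 / (n : ℝ) ^ 2) * ∑ k, b'' (X k ω ⬝ᵥ β₀) * (X k ω i * X k ω j) *
          (1 / ((r : ℝ) * (w (X k ω) / ∑ l, w (X l ω))) - 1 / (r : ℝ) + 1) ∂μ)
        = ((1 / (r : ℝ) * (((n : ℝ) - 1) / (n : ℝ)) * m) • Λ + (1 / (n : ℝ)) • Φ) i j := by
  intro i j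
  have hfmeas : Measurable fun x : Fin p → ℝ => b'' (x ⬝ᵥ β₀) * (x i * x j) := by
    apply Continuous.measurable
    fun_prop
  have hwmeas : Measurable w := by
    rw [funext hw]
    unfold euclNorm
    apply Continuous.measurable
    fun_prop
  have hn0 : (n : ℝ) ≠ 0 := by positivity
  rw [integral_const_mul, integral_sum_mul_inv_sampling_prob hindep hident hfmeas hwmeas hwpos
    (hΦint i j) hmint (hΛint i j), hΦ, hΛ, hm, Fintype.card_fin]
  simp only [Matrix.add_apply, Matrix.smul_apply, Matrix.of_apply, smul_eq_mul]
  field_simp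
end
end

section
/- Let (vᵢ)_{i≥1} be i.i.d. random vectors in ℝ^d, let B > 0, and for each n let W_{n,1}, …, W_{n,n} be real random variables on the same probability space such that (i) |W_{n,i}| ≤ B almost surely for all n, i; (ii) for each fixed i, W_{n,i} → 0 in probability as n → ∞; (iii) for each n, the pairs (W_{n,i}, vᵢ), i = 1, …, n, are identically distributed. Let g₂ : ℝ^d → ℝ be measurable with E|g₂(v₁)| < ∞. Then (1/n) Σ_{i=1}^n W_{n,i} g₂(vᵢ) → 0 in probability as n → ∞. -/
open MeasureTheory ProbabilityTheory Filter

noncomputable section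

/-- Dominated convergence for bounded multipliers: if `W n` is uniformly bounded and tends to `0`
in measure, then `W n * f` tends to `0` in `L¹` for every integrable `f`. -/
lemma tendsto_eLpNorm_mul_of_tendstoInMeasure_zero {Ω : Type*} [MeasurableSpace Ω]
    {μ : Measure Ω} {W : ℕ → Ω → ℝ} {f : Ω → ℝ} {B : ℝ}
    (hW : ∀ n, AEStronglyMeasurable (W n) μ) (hbdd : ∀ n, ∀ᵐ ω ∂μ, |W n ω| ≤ B)
    (hto : TendstoInMeasure μ W atTop (fun _ => (0 : ℝ))) (hf : Integrable f μ) :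
    Tendsto (fun n => eLpNorm (fun ω => W n ω * f ω) 1 μ) atTop (nhds 0) := by
  refine tendsto_of_subseq_tendsto fun ns hns => ?_
  obtain ⟨ms, -, hae⟩ := (hto.comp hns).exists_seq_tendsto_ae
  refine ⟨ms, ?_⟩
  simp only [eLpNorm_one_eq_lintegral_enorm]
  have hlim : Tendsto (fun k => ∫⁻ ω, ‖W (ns (ms k)) ω * f ω‖ₑ ∂μ) atTop
      (nhds (∫⁻ _, 0 ∂μ)) := by
    refine tendsto_lintegral_of_dominated_convergence' (fun ω => ‖B * f ω‖ₑ)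
      (fun k => ((hW _).mul hf.1).enorm) (fun k => ?_) (hf.const_mul B).2.ne ?_
    · filter_upwards [hbdd (ns (ms k))] with ω hω
      rw [enorm_le_iff_norm_le, norm_mul, norm_mul]
      exact mul_le_mul_of_nonneg_right (hω.trans (le_abs_self B)) (norm_nonneg _)
    · filter_upwards [hae] with ω hω
      simpa using (hω.mul_const (f ω)).enorm
  simpa using hlim

/-- The `L^p` seminorm of an average of identically distributed variables is at most that of a
single one of them. -/
lemma eLpNorm_average_le_of_identDistrib {Ω : Type*} [MeasurableSpace Ω] {μ : Measure Ω}
    {p : ENNReal} (hp : 1 ≤ p) {Y : ℕ → Ω → ℝ} {n : ℕ}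
    (hY : ∀ i < n, IdentDistrib (Y i) (Y 0) μ μ) :
    eLpNorm (fun ω => (1 / (n : ℝ)) * ∑ i ∈ Finset.range n, Y i ω) p μ ≤ eLpNorm (Y 0) p μ := by
  rcases Nat.eq_zero_or_pos n with rfl | hn
  · simp
  have hn' : (n : ℝ) ≠ 0 := by positivity
  have hsum : eLpNorm (∑ i ∈ Finset.range n, Y i) p μ ≤ n * eLpNorm (Y 0) p μ := by
    refine (eLpNorm_sum_le (fun i hi => ?_) hp).trans_eq ?_
    · exact (hY i (Finset.mem_range.1 hi)).aemeasurable_fst.aestronglyMeasurable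
    · rw [Finset.sum_congr rfl fun i hi => (hY i (Finset.mem_range.1 hi)).eLpNorm_eq p]
      simp
  have hcast : ‖(n : ℝ)‖ₑ = n := by
    rw [Real.enorm_eq_ofReal n.cast_nonneg, ENNReal.ofReal_natCast]
  calc eLpNorm (fun ω => (1 / (n : ℝ)) * ∑ i ∈ Finset.range n, Y i ω) p μ
      = eLpNorm ((1 / (n : ℝ)) • ∑ i ∈ Finset.range n, Y i) p μ := by
        congr 1
        ext ω
        simp
    _ = ‖1 / (n : ℝ)‖ₑ * eLpNorm (∑ i ∈ Finset.range n, Y i) p μ := eLpNorm_const_smul ..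
    _ ≤ ‖1 / (n : ℝ)‖ₑ * (n * eLpNorm (Y 0) p μ) := by gcongr
    _ = ‖1 / (n : ℝ) * n‖ₑ * eLpNorm (Y 0) p μ := by rw [enorm_mul, mul_assoc, hcast]
    _ = eLpNorm (Y 0) p μ := by simp [hn']

/-- Lemma 1 of Wang 2019, as used in the paper: for i.i.d. random
vectors `vᵢ`, uniformly bounded weights `W_{n,i}` that tend to `0` in probability
for each fixed `i`, with `(W_{n,i}, vᵢ)` identically distributed in `i` for each
`n`, and `g₂` integrable, `(1/n)∑_{i<n} W_{n,i} g₂(vᵢ) → 0` in probability. -/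
theorem weighted_average_tendsto_zero_in_measure
    {Ω : Type*} [MeasurableSpace Ω] (μ : Measure Ω) [IsProbabilityMeasure μ]
    {d : ℕ} (v : ℕ → Ω → Fin d → ℝ)
    (hv : ∀ i, Measurable (v i))
    (hindep : iIndepFun v μ)
    (hident : ∀ i, IdentDistrib (v i) (v 0) μ μ)
    (B : ℝ) (hB : 0 < B)
    (W : ℕ → ℕ → Ω → ℝ) (hWmeas : ∀ n i, Measurable (W n i))
    (hWbdd : ∀ n i, ∀ᵐ ω ∂μ, |W n i ω| ≤ B)
    (hWto0 : ∀ i, TendstoInMeasure μ (fun n => W n i) atTop (fun _ => (0 : ℝ)))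
    (hpairs : ∀ n, ∀ i < n, ∀ j < n,
      IdentDistrib (fun ω => (W n i ω, v i ω)) (fun ω => (W n j ω, v j ω)) μ μ)
    (g₂ : (Fin d → ℝ) → ℝ) (hg₂ : Measurable g₂)
    (hg₂int : Integrable (fun ω => g₂ (v 0 ω)) μ) :
    TendstoInMeasure μ
      (fun (n : ℕ) ω => (1 / (n : ℝ)) * ∑ i ∈ Finset.range n, W n i ω * g₂ (v i ω))
      atTop (fun _ => (0 : ℝ)) := by
  have hmeas : ∀ n i, Measurable fun ω => W n i ω * g₂ (v i ω) := fun n i =>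
    (hWmeas n i).mul (hg₂.comp (hv i))
  refine tendstoInMeasure_of_tendsto_eLpNorm one_ne_zero (fun n => ?_)
    aestronglyMeasurable_const ?_
  · exact ((Finset.measurable_fun_sum _ fun i _ => hmeas n i).const_mul _).aestronglyMeasurable
  refine tendsto_of_tendsto_of_tendsto_of_le_of_le tendsto_const_nhds
    (tendsto_eLpNorm_mul_of_tendstoInMeasure_zero (fun n => (hWmeas n 0).aestronglyMeasurable)
      (fun n => hWbdd n 0) (hWto0 0) hg₂int) (fun _ => zero_le) fun n => ?_
  have hfun : ((fun ω => (1 / (n : ℝ)) * ∑ i ∈ Finset.range n, W n i ω * g₂ (v i ω)) -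
      fun _ => (0 : ℝ)) = fun ω => (1 / (n : ℝ)) * ∑ i ∈ Finset.range n, W n i ω * g₂ (v i ω) :=
    sub_zero _
  simp only [hfun]
  exact eLpNorm_average_le_of_identDistrib (Y := fun i ω => W n i ω * g₂ (v i ω)) le_rfl
    fun i hi => (hpairs n i hi 0 (Nat.zero_lt_of_lt hi)).comp
      (measurable_fst.mul (hg₂.comp measurable_snd))
end
end

section
/- Let X₁, X₂, … be i.i.d. copies of a random vector X in ℝ^p with E[‖X‖²] < ∞, let b'' : ℝ → ℝ be a bounded, continuous, nonnegative function, and let β₀ ∈ ℝ^p. Let (β̂ₙ) be a sequence of random vectors in ℝ^p on the same probability space with β̂ₙ → β₀ in probability, and assume that for each n the pairs (Xᵢ, β̂ₙ), i = 1, …, n, are identically distributed. Then (1/n) Σ_{i=1}^n b''(Xᵢᵀβ̂ₙ) Xᵢ Xᵢᵀ → E[b''(Xᵀβ₀) X Xᵀ] in probability (entrywise, equivalently in Frobenius norm). -/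
open MeasureTheory ProbabilityTheory Filter Matrix

noncomputable section

lemma abs_mul_apply_le_euclNorm_sq {p : ℕ} (v : Fin p → ℝ) (i j : Fin p) :
    |v i * v j| ≤ euclNorm v ^ 2 := by
  have hsq : euclNorm v ^ 2 = ∑ k, v k ^ 2 :=
    Real.sq_sqrt (Finset.sum_nonneg fun k _ => sq_nonneg (v k))
  have hle (k : Fin p) : v k ^ 2 ≤ euclNorm v ^ 2 :=
    hsq ▸ Finset.single_le_sum (f := fun k => v k ^ 2) (fun k _ => sq_nonneg (v k))
      (Finset.mem_univ k)
  rw [abs_mul]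
  nlinarith [hle i, hle j, sq_abs (v i), sq_abs (v j), sq_nonneg (|v i| - |v j|)]

/-- Dominated convergence for a bounded continuous function of a linear form whose coefficient
vector converges in measure. -/
lemma tendsto_eLpNorm_one_comp_dotProduct_sub {Ω : Type*} [MeasurableSpace Ω] {μ : Measure Ω}
    {p : ℕ} {Z : Ω → Fin p → ℝ} (hZ : Measurable Z) {w : Ω → ℝ} (hw : Integrable w μ)
    {f : ℝ → ℝ} (hf : Continuous f) {M : ℝ} (hM : ∀ t, |f t| ≤ M)
    {B : ℕ → Ω → Fin p → ℝ} (hB : ∀ n, Measurable (B n)) {β : Fin p → ℝ}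
    (hBto : TendstoInMeasure μ B atTop fun _ => β) :
    Tendsto (fun n => eLpNorm (fun ω => (f (Z ω ⬝ᵥ B n ω) - f (Z ω ⬝ᵥ β)) * w ω) 1 μ)
      atTop (nhds 0) := by
  refine tendsto_of_subseq_tendsto fun ns hns => ?_
  obtain ⟨ms, -, hms⟩ := (hBto.comp hns).exists_seq_tendsto_ae
  refine ⟨ms, ?_⟩
  simp only [eLpNorm_one_eq_lintegral_enorm]
  rw [← lintegral_zero (μ := μ)]
  refine tendsto_lintegral_of_dominated_convergence' (fun ω => ‖(2 * M) * w ω‖ₑ)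
    (fun n => ?_) (fun n => ae_of_all _ fun ω => ?_) (hw.const_mul (2 * M)).2.ne ?_
  · have hdot : Measurable fun ω => Z ω ⬝ᵥ B (ns (ms n)) ω := by
      simp only [dotProduct]
      fun_prop
    have hdot' : Measurable fun ω => Z ω ⬝ᵥ β := by
      simp only [dotProduct]
      fun_prop
    exact (((hf.measurable.comp hdot).sub (hf.measurable.comp hdot')).aemeasurable.mul
      hw.aemeasurable).enorm
  · refine enorm_le_iff_norm_le.2 ?_
    rw [norm_mul, norm_mul]
    gcongr
    have h₁ := abs_sub (f (Z ω ⬝ᵥ B (ns (ms n)) ω)) (f (Z ω ⬝ᵥ β))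
    have h₂ := hM (Z ω ⬝ᵥ B (ns (ms n)) ω)
    have h₃ := hM (Z ω ⬝ᵥ β)
    rw [Real.norm_eq_abs, Real.norm_eq_abs]
    exact (by linarith : _ ≤ 2 * M).trans (le_abs_self _)
  · filter_upwards [hms] with ω hω
    have hcont : Continuous fun v : Fin p → ℝ => ‖(f (Z ω ⬝ᵥ v) - f (Z ω ⬝ᵥ β)) * w ω‖ₑ := by
      simp only [dotProduct]
      fun_prop
    simpa [Function.comp_def] using (hcont.tendsto β).comp hω

/-- The `L¹` norm of an average of functions with equal `L¹` norms is at most the common norm. -/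
lemma eLpNorm_average_le {Ω : Type*} [MeasurableSpace Ω] {μ : Measure Ω} {n : ℕ}
    {Y : ℕ → Ω → ℝ} (hY : ∀ k, AEStronglyMeasurable (Y k) μ)
    (heq : ∀ k < n, eLpNorm (Y k) 1 μ = eLpNorm (Y 0) 1 μ) :
    eLpNorm ((n : ℝ)⁻¹ • ∑ k ∈ Finset.range n, Y k) 1 μ ≤ eLpNorm (Y 0) 1 μ := by
  rcases Nat.eq_zero_or_pos n with rfl | hn
  · simp
  have hn' : (n : ℝ) ≠ 0 := by positivity
  calc eLpNorm ((n : ℝ)⁻¹ • ∑ k ∈ Finset.range n, Y k) 1 μ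
      ≤ ‖(n : ℝ)⁻¹‖ₑ * ∑ k ∈ Finset.range n, eLpNorm (Y k) 1 μ := by
        rw [eLpNorm_const_smul]
        gcongr
        exact eLpNorm_sum_le (fun k _ => hY k) le_rfl
    _ = ‖(n : ℝ)⁻¹‖ₑ * (n * eLpNorm (Y 0) 1 μ) := by
        rw [Finset.sum_congr rfl fun k hk => heq k (Finset.mem_range.1 hk)]
        simp
    _ = eLpNorm (Y 0) 1 μ := by
        rw [← mul_assoc, enorm_inv hn', Real.enorm_natCast,
          ENNReal.inv_mul_cancel (by exact_mod_cast hn.ne') (ENNReal.natCast_ne_top n), one_mul]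

/-- plugging a consistent estimator `β̂ₙ` into the empirical
information matrix, `(1/n)∑_{k<n} b''(Xₖᵀβ̂ₙ)XₖXₖᵀ → E[b''(Xᵀβ₀)XXᵀ]`
in probability, entrywise. -/
theorem empirical_information_tendsto_in_measure
    {Ω : Type*} [MeasurableSpace Ω] (μ : Measure Ω) [IsProbabilityMeasure μ]
    {p : ℕ} (X : ℕ → Ω → Fin p → ℝ) (X₀ : Ω → Fin p → ℝ)
    (hmeas : ∀ i, Measurable (X i)) (hX₀ : Measurable X₀)
    (hindep : iIndepFun X μ)
    (hident : ∀ i, IdentDistrib (X i) X₀ μ μ)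
    (hmom : Integrable (fun ω => euclNorm (X₀ ω) ^ 2) μ)
    (b'' : ℝ → ℝ) (hb_cont : Continuous b'') (hb_bdd : ∃ M, ∀ t, |b'' t| ≤ M)
    (hb_nonneg : ∀ t, 0 ≤ b'' t)
    (β₀ : Fin p → ℝ)
    (βh : ℕ → Ω → Fin p → ℝ) (hβmeas : ∀ n, Measurable (βh n))
    (hβto : TendstoInMeasure μ βh atTop (fun _ => β₀))
    (hpair : ∀ n, ∀ i < n, ∀ j < n,
      IdentDistrib (fun ω => (X i ω, βh n ω)) (fun ω => (X j ω, βh n ω)) μ μ) :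
    ∀ i j, TendstoInMeasure μ
      (fun (n : ℕ) ω => (1 / (n : ℝ)) *
        ∑ k ∈ Finset.range n, b'' (X k ω ⬝ᵥ βh n ω) * (X k ω i * X k ω j))
      atTop (fun _ => ∫ ω, b'' (X₀ ω ⬝ᵥ β₀) * (X₀ ω i * X₀ ω j) ∂μ) := by
  intro i j
  obtain ⟨M, hM⟩ := hb_bdd
  have hb := hb_cont.measurable
  have hh : Measurable fun x : Fin p → ℝ => b'' (x ⬝ᵥ β₀) * (x i * x j) := by
    simp only [dotProduct]
    fun_prop
  have hg : Measurable fun q : (Fin p → ℝ) × (Fin p → ℝ) =>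
      (b'' (q.1 ⬝ᵥ q.2) - b'' (q.1 ⬝ᵥ β₀)) * (q.1 i * q.1 j) := by
    simp only [dotProduct]
    fun_prop
  have hw₀ : Integrable (fun ω => X₀ ω i * X₀ ω j) μ :=
    hmom.mono' (by fun_prop) (ae_of_all _ fun ω => abs_mul_apply_le_euclNorm_sq (X₀ ω) i j)
  have hw : Integrable (fun ω => X 0 ω i * X 0 ω j) μ :=
    ((hident 0).comp (u := fun x : Fin p → ℝ => x i * x j) (by fun_prop)).integrable_iff.2 hw₀
  let Y : ℕ → Ω → ℝ := fun k ω => b'' (X k ω ⬝ᵥ β₀) * (X k ω i * X k ω j)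
  let D : ℕ → ℕ → Ω → ℝ := fun n k ω =>
    (b'' (X k ω ⬝ᵥ βh n ω) - b'' (X k ω ⬝ᵥ β₀)) * (X k ω i * X k ω j)
  have hYm (k : ℕ) : Measurable (Y k) := hh.comp (hmeas k)
  have hDm (n k : ℕ) : Measurable (D n k) := hg.comp ((hmeas k).prodMk (hβmeas n))
  have hYint : Integrable (Y 0) μ := by
    refine hw.bdd_mul (c := M) ?_ (ae_of_all _ fun ω => hM _)
    have hdot : Measurable fun ω => X 0 ω ⬝ᵥ β₀ := by
      simp only [dotProduct]
      fun_prop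
    exact (hb.comp hdot).aestronglyMeasurable
  have hmean : μ[Y 0] = ∫ ω, b'' (X₀ ω ⬝ᵥ β₀) * (X₀ ω i * X₀ ω j) ∂μ :=
    ((hident 0).comp hh).integral_eq
  have hlaw := strong_law_Lp (μ := μ) le_rfl ENNReal.one_ne_top Y
    (memLp_one_iff_integrable.2 hYint)
    (fun k l hkl => (hindep.indepFun hkl).comp hh hh)
    (fun k => ((hident k).trans (hident 0).symm).comp hh)
  have hplug : Tendsto (fun n => eLpNorm (D n 0) 1 μ) atTop (nhds 0) :=
    tendsto_eLpNorm_one_comp_dotProduct_sub (hmeas 0) hw hb_cont hM hβmeas hβto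
  have hDle (n : ℕ) : eLpNorm ((n : ℝ)⁻¹ • ∑ k ∈ Finset.range n, D n k) 1 μ ≤
      eLpNorm (D n 0) 1 μ :=
    eLpNorm_average_le (fun k => (hDm n k).aestronglyMeasurable) fun k hk =>
      ((hpair n k hk 0 (by omega)).comp hg).eLpNorm_eq 1
  rw [← hmean]
  refine tendstoInMeasure_of_tendsto_eLpNorm one_ne_zero (fun n => ?_) (by fun_prop) ?_
  · have hF : Measurable fun q : (Fin p → ℝ) × (Fin p → ℝ) =>
        b'' (q.1 ⬝ᵥ q.2) * (q.1 i * q.1 j) := by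
      simp only [dotProduct]
      fun_prop
    exact ((Finset.measurable_fun_sum _ fun k _ =>
      hF.comp ((hmeas k).prodMk (hβmeas n))).const_mul _).aestronglyMeasurable
  refine tendsto_of_tendsto_of_tendsto_of_le_of_le tendsto_const_nhds
    (by simpa using hplug.add hlaw) (fun _ => zero_le) fun n => ?_
  refine le_trans ?_ (add_le_add_left (hDle n) _)
  refine le_trans (le_of_eq ?_) (eLpNorm_add_le ?_ ?_ le_rfl)
  · congr 1
    ext ω
    simp only [Y, D, Pi.sub_apply, Pi.add_apply, Pi.smul_apply, Finset.sum_apply, smul_eq_mul,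
      sub_mul, Finset.sum_sub_distrib]
    ring
  · exact (Finset.aestronglyMeasurable_sum _ fun k _ =>
      (hDm n k).aestronglyMeasurable).const_smul (n : ℝ)⁻¹
  · have hsum : Measurable fun ω => ∑ k ∈ Finset.range n, Y k ω :=
      Finset.measurable_fun_sum _ fun k _ => hYm k
    exact ((hsum.const_mul _).sub_const _).aestronglyMeasurable
end
end

section
/- Let X₁, X₂, … be i.i.d. copies of a random vector X in ℝ^p with E[‖X‖] < ∞, let b'' : ℝ → ℝ be a bounded, continuous, nonnegative function, β₀ ∈ ℝ^p, L a fixed real p×p matrix, and Φ := E[b''(Xᵀβ₀) X Xᵀ] positive definite. Let (β̂ₙ) be random vectors with β̂ₙ → β₀ in probability, and (Φ̂ₙ) random symmetric positive-definite p×p matrices with Φ̂ₙ → Φ in probability and λ_max(Φ̂ₙ⁻¹) ≤ C almost surely for a finite constant C. Assume that for each n the triples (Xᵢ, β̂ₙ, Φ̂ₙ), i = 1, …, n, are identically distributed. Then (1/n) Σ_{i=1}^n (b''(Xᵢᵀβ̂ₙ))^{1/2} ‖LΦ̂ₙ⁻¹Xᵢ‖ → E[(b''(Xᵀβ₀))^{1/2}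 ‖LΦ⁻¹X‖] in probability. -/
open MeasureTheory ProbabilityTheory Filter Matrix

noncomputable section

open scoped Topology ENNReal

section EuclNorm

variable {p : ℕ}

lemma continuous_euclNorm : Continuous (euclNorm : (Fin p → ℝ) → ℝ) := by
  unfold euclNorm
  fun_prop

lemma euclNorm_nonneg (v : Fin p → ℝ) : 0 ≤ euclNorm v := Real.sqrt_nonneg _

lemma abs_apply_le_euclNorm (v : Fin p → ℝ) (i : Fin p) : |v i| ≤ euclNorm v := by
  rw [← Real.sqrt_sq_eq_abs]
  exact Real.sqrt_le_sqrt
    (Finset.single_le_sum (f := fun i => v i ^ 2) (fun _ _ => sq_nonneg _) (Finset.mem_univ i))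

lemma euclNorm_le_sum_abs (v : Fin p → ℝ) : euclNorm v ≤ ∑ i, |v i| := by
  refine (Real.sqrt_le_left (Finset.sum_nonneg fun _ _ => abs_nonneg _)).2 ?_
  calc ∑ i, v i ^ 2 = ∑ i, |v i| ^ 2 := by simp
    _ ≤ (∑ i, |v i|) ^ 2 := Finset.sum_sq_le_sq_sum_of_nonneg fun _ _ => abs_nonneg _

lemma euclNorm_mulVec_le (A : Matrix (Fin p) (Fin p) ℝ) (v : Fin p → ℝ) :
    euclNorm (A *ᵥ v) ≤ (∑ i, ∑ j, |A i j|) * euclNorm v := by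
  refine (euclNorm_le_sum_abs _).trans ?_
  simp_rw [Finset.sum_mul]
  refine Finset.sum_le_sum fun i _ => ?_
  rw [Matrix.mulVec, dotProduct]
  refine (Finset.abs_sum_le_sum_abs _ _).trans (Finset.sum_le_sum fun j _ => ?_)
  rw [abs_mul]
  exact mul_le_mul_of_nonneg_left (abs_apply_le_euclNorm v j) (abs_nonneg _)

end EuclNorm

/-- The entries of a positive semidefinite matrix dominated by `C • 1` are bounded by `C`. -/
lemma Matrix.PosSemidef.abs_apply_le {n : Type*} [Fintype n] [DecidableEq n] {B : Matrix n n ℝ}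
    {C : ℝ} (hB : B.PosSemidef) (hC : (C • (1 : Matrix n n ℝ) - B).PosSemidef) (i j : n) :
    |B i j| ≤ C := by
  have hdiag (k : n) : B k k ≤ C := by
    have := hC.diag_nonneg (i := k)
    simpa using this
  have hsymm : B j i = B i j := by simpa using hB.isHermitian.apply i j
  have hadd := hB.dotProduct_mulVec_nonneg (Pi.single i 1 + Pi.single j 1)
  have hsub := hB.dotProduct_mulVec_nonneg (Pi.single i 1 - Pi.single j 1)
  simp [Matrix.mulVec_add, Matrix.mulVec_sub, add_dotProduct, sub_dotProduct, hsymm] at hadd hsub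
  have := hdiag i
  have := hdiag j
  rw [abs_le]
  constructor <;> linarith

lemma sum_abs_mul_apply_le {p : ℕ} (L B : Matrix (Fin p) (Fin p) ℝ) {C : ℝ}
    (hB : ∀ i j, |B i j| ≤ C) :
    ∑ i, ∑ j, |(L * B) i j| ≤ ∑ i, ∑ _j : Fin p, ∑ k, |L i k| * C := by
  refine Finset.sum_le_sum fun i _ => Finset.sum_le_sum fun j _ => ?_
  rw [Matrix.mul_apply]
  refine (Finset.abs_sum_le_sum_abs _ _).trans (Finset.sum_le_sum fun k _ => ?_)
  rw [abs_mul]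
  exact mul_le_mul_of_nonneg_left (hB k j) (abs_nonneg _)

/-- Coordinatewise convergence in measure in a finite product implies convergence in measure. -/
lemma tendstoInMeasure_pi {α κ ι : Type*} {E : ι → Type*} [MeasurableSpace α] {μ : Measure α}
    [Fintype ι] [∀ i, PseudoEMetricSpace (E i)] {l : Filter κ} {f : κ → α → ∀ i, E i}
    {g : α → ∀ i, E i}
    (h : ∀ i, TendstoInMeasure μ (fun n x => f n x i) l (fun x => g x i)) :
    TendstoInMeasure μ f l g := by
  intro ε hε
  have hsum : Tendsto (fun n => ∑ i, μ {x | ε ≤ edist (f n x i) (g x i)}) l (𝓝 0) := by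
    simpa using tendsto_finsetSum Finset.univ fun i _ => h i ε hε
  refine tendsto_of_tendsto_of_tendsto_of_le_of_le tendsto_const_nhds hsum
    (fun _ => zero_le) fun n => ?_
  refine (measure_mono fun x hx => ?_).trans (measure_iUnion_fintype_le μ _)
  by_contra hcon
  simp only [Set.mem_iUnion, Set.mem_ofPred_eq, not_exists, not_le] at hcon hx
  rw [edist_pi_def] at hx
  exact absurd hx (not_le.2 ((Finset.sup_lt_iff hε).2 fun i _ => hcon i))

section WeightedNorm

variable {p : ℕ}

/-- The summand `(b (xᵀβ))^{1/2} ‖L A⁻¹ x‖` as a function of the triple `(x, β, A)`. -/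
def weightedNorm (b : ℝ → ℝ) (L : Matrix (Fin p) (Fin p) ℝ)
    (z : (Fin p → ℝ) × (Fin p → ℝ) × (Fin p → Fin p → ℝ)) : ℝ :=
  Real.sqrt (b (z.1 ⬝ᵥ z.2.1)) * euclNorm ((L * (Matrix.of z.2.2)⁻¹) *ᵥ z.1)

lemma weightedNorm_nonneg (b : ℝ → ℝ) (L : Matrix (Fin p) (Fin p) ℝ)
    (z : (Fin p → ℝ) × (Fin p → ℝ) × (Fin p → Fin p → ℝ)) : 0 ≤ weightedNorm b L z :=
  mul_nonneg (Real.sqrt_nonneg _) (euclNorm_nonneg _)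

lemma measurable_inv_apply (i j : Fin p) :
    Measurable fun A : Fin p → Fin p → ℝ => (Matrix.of A)⁻¹ i j := by
  have hof : Continuous fun A : Fin p → Fin p → ℝ => (Matrix.of A) := continuous_id
  simp only [Matrix.inv_def, Ring.inverse_eq_inv', Matrix.smul_apply, smul_eq_mul]
  exact hof.matrix_det.measurable.inv.mul
    ((hof.matrix_adjugate.matrix_elem i j).measurable)

lemma measurable_weightedNorm {b : ℝ → ℝ} (hb : Continuous b) (L : Matrix (Fin p) (Fin p) ℝ) :
    Measurable (weightedNorm b L) := by
  have hdot : Measurable fun z : (Fin p → ℝ) × (Fin p → ℝ) × (Fin p → Fin p → ℝ) =>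
      z.1 ⬝ᵥ z.2.1 :=
    (Continuous.dotProduct continuous_fst (continuous_fst.comp continuous_snd)).measurable
  refine (hb.measurable.comp hdot).sqrt.mul (continuous_euclNorm.measurable.comp ?_)
  refine measurable_pi_lambda _ fun i => ?_
  simp only [Matrix.mulVec, dotProduct, Matrix.mul_apply]
  refine Finset.measurable_sum _ fun j _ => Measurable.mul ?_ (by fun_prop)
  refine Finset.measurable_sum _ fun k _ => Measurable.const_mul ?_ _
  exact (measurable_inv_apply k j).comp (measurable_snd.comp measurable_snd)

lemma continuousAt_weightedNorm {b : ℝ → ℝ} (hb : Continuous b) (L : Matrix (Fin p) (Fin p) ℝ)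
    {z : (Fin p → ℝ) × (Fin p → ℝ) × (Fin p → Fin p → ℝ)} (hz : (Matrix.of z.2.2).det ≠ 0) :
    ContinuousAt (weightedNorm b L) z := by
  have hof : ContinuousAt (fun z : (Fin p → ℝ) × (Fin p → ℝ) × (Fin p → Fin p → ℝ) =>
      Matrix.of z.2.2) z := (continuous_snd.comp continuous_snd).continuousAt
  have hinv : ContinuousAt (Inv.inv : Matrix (Fin p) (Fin p) ℝ → _) (Matrix.of z.2.2) := by
    refine continuousAt_matrix_inv _ ?_
    simpa using continuousAt_inv₀ hz
  have hinv' : ContinuousAt (fun z : (Fin p → ℝ) × (Fin p → ℝ) × (Fin p → Fin p → ℝ) =>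
      (Matrix.of z.2.2)⁻¹) z := hinv.tendsto.comp hof
  have hmul : Continuous fun q : Matrix (Fin p) (Fin p) ℝ × (Fin p → ℝ) => (L * q.1) *ᵥ q.2 :=
    (continuous_const.matrix_mul continuous_fst).matrix_mulVec continuous_snd
  have hdot : Continuous fun z : (Fin p → ℝ) × (Fin p → ℝ) × (Fin p → Fin p → ℝ) =>
      Real.sqrt (b (z.1 ⬝ᵥ z.2.1)) :=
    (hb.comp (Continuous.dotProduct continuous_fst (continuous_fst.comp continuous_snd))).sqrt
  refine hdot.continuousAt.mul (continuous_euclNorm.continuousAt.comp ?_)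
  exact hmul.continuousAt.comp
    (f := fun z : (Fin p → ℝ) × (Fin p → ℝ) × (Fin p → Fin p → ℝ) => ((Matrix.of z.2.2)⁻¹, z.1))
    (hinv'.prodMk continuous_fst.continuousAt)

lemma weightedNorm_le {b : ℝ → ℝ} {M : ℝ} (hM : ∀ t, |b t| ≤ M) (L : Matrix (Fin p) (Fin p) ℝ)
    (z : (Fin p → ℝ) × (Fin p → ℝ) × (Fin p → Fin p → ℝ)) {K : ℝ}
    (hK : ∑ i, ∑ j, |(L * (Matrix.of z.2.2)⁻¹) i j| ≤ K) :
    weightedNorm b L z ≤ Real.sqrt M * K * euclNorm z.1 := by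
  rw [mul_assoc]
  refine mul_le_mul (Real.sqrt_le_sqrt ((le_abs_self _).trans (hM _))) ?_ (euclNorm_nonneg _)
    (Real.sqrt_nonneg _)
  exact (euclNorm_mulVec_le _ _).trans (mul_le_mul_of_nonneg_right hK (euclNorm_nonneg _))

end WeightedNorm

/-- The `L¹` norm of an average is at most a common bound for the `L¹` norms of the terms. -/
lemma eLpNorm_average_le_s10 {Ω : Type*} [MeasurableSpace Ω] {μ : Measure Ω} {n : ℕ}
    {D : ℕ → Ω → ℝ} {c : ℝ≥0∞} (hD : ∀ k, AEStronglyMeasurable (D k) μ)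
    (hc : ∀ k < n, eLpNorm (D k) 1 μ ≤ c) :
    eLpNorm (fun ω => (1 / (n : ℝ)) * ∑ k ∈ Finset.range n, D k ω) 1 μ ≤ c := by
  rcases Nat.eq_zero_or_pos n with rfl | hn
  · simp
  have hrew : (fun ω => (1 / (n : ℝ)) * ∑ k ∈ Finset.range n, D k ω)
      = (1 / (n : ℝ)) • ∑ k ∈ Finset.range n, D k := by
    ext ω
    simp
  have hsum : eLpNorm (∑ k ∈ Finset.range n, D k) 1 μ ≤ n * c := by
    refine (eLpNorm_sum_le (fun k _ => hD k) le_rfl).trans ?_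
    refine (Finset.sum_le_sum fun k hk => hc k (Finset.mem_range.1 hk)).trans ?_
    simp
  have hn0 : (n : ℝ≥0∞) ≠ 0 := by exact_mod_cast hn.ne'
  have hnorm : ‖(1 / (n : ℝ))‖ₑ = (n : ℝ≥0∞)⁻¹ := by
    rw [one_div, enorm_inv (by exact_mod_cast hn.ne')]
    simp
  rw [hrew, eLpNorm_const_smul, hnorm]
  calc (n : ℝ≥0∞)⁻¹ * eLpNorm (∑ k ∈ Finset.range n, D k) 1 μ
      ≤ (n : ℝ≥0∞)⁻¹ * (n * c) := by gcongr
    _ = c := by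
      rw [← mul_assoc, ENNReal.inv_mul_cancel hn0 (ENNReal.natCast_ne_top n), one_mul]

/-- consistency of `m̂`: with consistent pilot estimators `β̂ₙ` and
`Φ̂ₙ` (symmetric positive definite, `λ_max(Φ̂ₙ⁻¹) ≤ C` a.s., expressed by
`C•I − Φ̂ₙ⁻¹` being PSD since `Φ̂ₙ⁻¹` is symmetric),
`(1/n)∑_{k<n} (b''(Xₖᵀβ̂ₙ))^{1/2}‖LΦ̂ₙ⁻¹Xₖ‖ → E[(b''(Xᵀβ₀))^{1/2}‖LΦ⁻¹X‖]`
in probability. -/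
theorem mhat_tendsto_in_measure
    {Ω : Type*} [MeasurableSpace Ω] (μ : Measure Ω) [IsProbabilityMeasure μ]
    {p : ℕ} (X : ℕ → Ω → Fin p → ℝ) (X₀ : Ω → Fin p → ℝ)
    (hmeas : ∀ i, Measurable (X i)) (hX₀ : Measurable X₀)
    (hindep : iIndepFun X μ)
    (hident : ∀ i, IdentDistrib (X i) X₀ μ μ)
    (hmom : Integrable (fun ω => euclNorm (X₀ ω)) μ)
    (b'' : ℝ → ℝ) (hb_cont : Continuous b'') (hb_bdd : ∃ M, ∀ t, |b'' t| ≤ M)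
    (hb_nonneg : ∀ t, 0 ≤ b'' t)
    (β₀ : Fin p → ℝ) (L Φ : Matrix (Fin p) (Fin p) ℝ)
    (hΦint : ∀ i j, Integrable (fun ω => b'' (X₀ ω ⬝ᵥ β₀) * (X₀ ω i * X₀ ω j)) μ)
    (hΦ : Φ = Matrix.of fun i j => ∫ ω, b'' (X₀ ω ⬝ᵥ β₀) * (X₀ ω i * X₀ ω j) ∂μ)
    (hΦpd : Φ.PosDef)
    (βh : ℕ → Ω → Fin p → ℝ) (hβmeas : ∀ n, Measurable (βh n))
    (hβto : TendstoInMeasure μ βh atTop (fun _ => β₀))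
    (Φh : ℕ → Ω → Matrix (Fin p) (Fin p) ℝ)
    (hΦhmeas : ∀ n i j, Measurable (fun ω => Φh n ω i j))
    (C : ℝ)
    (hΦhpd : ∀ n, ∀ᵐ ω ∂μ, (Φh n ω).PosDef ∧
      (C • (1 : Matrix (Fin p) (Fin p) ℝ) - (Φh n ω)⁻¹).PosSemidef)
    (hΦhto : ∀ i j, TendstoInMeasure μ (fun n ω => Φh n ω i j) atTop (fun _ => Φ i j))
    (htriple : ∀ n, ∀ i < n, ∀ j < n,
      IdentDistrib (γ := (Fin p → ℝ) × (Fin p → ℝ) × (Fin p → Fin p → ℝ))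
        (fun ω => (X i ω, βh n ω, fun a b => Φh n ω a b))
        (fun ω => (X j ω, βh n ω, fun a b => Φh n ω a b)) μ μ) :
    TendstoInMeasure μ
      (fun (n : ℕ) ω => (1 / (n : ℝ)) * ∑ k ∈ Finset.range n,
        Real.sqrt (b'' (X k ω ⬝ᵥ βh n ω)) * euclNorm ((L * (Φh n ω)⁻¹).mulVec (X k ω)))
      atTop
      (fun _ => ∫ ω, Real.sqrt (b'' (X₀ ω ⬝ᵥ β₀)) * euclNorm ((L * Φ⁻¹).mulVec (X₀ ω)) ∂μ) := by
  obtain ⟨M, hM⟩ := hb_bdd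
  set G := weightedNorm b'' L
  have hGmeas : Measurable G := measurable_weightedNorm hb_cont L
  let T : ℕ → ℕ → Ω → (Fin p → ℝ) × (Fin p → ℝ) × (Fin p → Fin p → ℝ) :=
    fun n k ω => (X k ω, βh n ω, fun a b => Φh n ω a b)
  let θ : (Fin p → ℝ) → (Fin p → ℝ) × (Fin p → ℝ) × (Fin p → Fin p → ℝ) :=
    fun x => (x, β₀, fun a b => Φ a b)
  have hT (n k : ℕ) : Measurable (T n k) :=
    (hmeas k).prodMk ((hβmeas n).prodMk
      (measurable_pi_lambda _ fun a => measurable_pi_lambda _ fun b => hΦhmeas n a b))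
  have hθ : Measurable θ := measurable_id.prodMk measurable_const
  have hmomX : Integrable (fun ω => euclNorm (X 0 ω)) μ :=
    ((hident 0).comp continuous_euclNorm.measurable).integrable_iff.2 hmom
  -- the differences between the estimated and the ideal summands
  let D : ℕ → ℕ → Ω → ℝ := fun n k ω => G (T n k ω) - G (θ (X k ω))
  have hDmeas (n k : ℕ) : Measurable (D n k) :=
    (hGmeas.comp (hT n k)).sub (hGmeas.comp (hθ.comp (hmeas k)))
  set K₁ := ∑ i, ∑ _j : Fin p, ∑ k, |L i k| * C
  set K₂ := ∑ i, ∑ j, |(L * Φ⁻¹) i j|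
  have hGθ (x : Fin p → ℝ) : G (θ x) ≤ Real.sqrt M * K₂ * euclNorm x :=
    weightedNorm_le hM L (θ x) le_rfl
  have hDbound (n : ℕ) : ∀ᵐ ω ∂μ,
      ‖D n 0 ω‖ₑ ≤ ‖(Real.sqrt M * K₁ + Real.sqrt M * K₂) * euclNorm (X 0 ω)‖ₑ := by
    filter_upwards [hΦhpd n] with ω hω
    rw [enorm_le_iff_norm_le]
    have h₁ : G (T n 0 ω) ≤ Real.sqrt M * K₁ * euclNorm (X 0 ω) :=
      weightedNorm_le hM L (T n 0 ω)
        (sum_abs_mul_apply_le L _ (hω.1.posSemidef.inv.abs_apply_le hω.2))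
    have h₂ := hGθ (X 0 ω)
    have h₃ : 0 ≤ G (T n 0 ω) := weightedNorm_nonneg _ _ _
    have h₄ : 0 ≤ G (θ (X 0 ω)) := weightedNorm_nonneg _ _ _
    refine le_trans ?_ (le_abs_self _)
    rw [add_mul, Real.norm_eq_abs, abs_le]
    constructor <;> simp only [D] <;> linarith
  have hΦto : TendstoInMeasure μ (fun n ω => fun a b => Φh n ω a b) atTop
      (fun _ => fun a b => Φ a b) :=
    tendstoInMeasure_pi fun a => tendstoInMeasure_pi fun b => hΦhto a b
  have hDto : Tendsto (fun n => eLpNorm (D n 0) 1 μ) atTop (𝓝 0) := by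
    refine tendsto_of_subseq_tendsto fun ns hns => ?_
    obtain ⟨ms, hms, hβae⟩ := (hβto.comp hns).exists_seq_tendsto_ae
    obtain ⟨ks, hks, hΦae⟩ := ((hΦto.comp hns).comp hms.tendsto_atTop).exists_seq_tendsto_ae
    refine ⟨ms ∘ ks, ?_⟩
    simp_rw [eLpNorm_one_eq_lintegral_enorm]
    rw [← lintegral_zero (μ := μ)]
    refine tendsto_lintegral_of_dominated_convergence _ (fun n => (hDmeas _ _).enorm)
      (fun n => hDbound _) (hmomX.const_mul _).2.ne ?_
    filter_upwards [hβae, hΦae] with ω hβω hΦω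
    have hcont : ContinuousAt G (θ (X 0 ω)) :=
      continuousAt_weightedNorm hb_cont L hΦpd.det_pos.ne'
    have hTto : Tendsto (fun n => T (ns (ms (ks n))) 0 ω) atTop (𝓝 (θ (X 0 ω))) :=
      tendsto_const_nhds.prodMk_nhds ((hβω.comp hks.tendsto_atTop).prodMk_nhds hΦω)
    have := ((hcont.tendsto.comp hTto).sub_const (G (θ (X 0 ω)))).enorm
    simpa using this
  have hDeq (n : ℕ) (k : ℕ) (hk : k < n) : eLpNorm (D n k) 1 μ = eLpNorm (D n 0) 1 μ := by
    have hH : Measurable fun z : (Fin p → ℝ) × (Fin p → ℝ) × (Fin p → Fin p → ℝ) =>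
        G z - G (θ z.1) := hGmeas.sub (hGmeas.comp (hθ.comp measurable_fst))
    exact ((htriple n k hk 0 (by omega)).comp hH).eLpNorm_eq 1
  have havg : TendstoInMeasure μ
      (fun (n : ℕ) ω => (1 / (n : ℝ)) * ∑ k ∈ Finset.range n, D n k ω) atTop (fun _ => 0) := by
    refine tendstoInMeasure_of_tendsto_eLpNorm one_ne_zero (fun n => ?_)
      aestronglyMeasurable_const ?_
    · exact ((Finset.measurable_sum _ fun k _ => hDmeas n k).const_mul _).aestronglyMeasurable
    · refine tendsto_of_tendsto_of_tendsto_of_le_of_le tendsto_const_nhds hDto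
        (fun _ => zero_le) fun n => ?_
      have := eLpNorm_average_le_s10 (n := n) (fun k => (hDmeas n k).aestronglyMeasurable (μ := μ))
        fun k hk => (hDeq n k hk).le
      exact (congrArg (eLpNorm · 1 μ) (sub_zero _)).trans_le this
  have hGθm : Measurable fun x => G (θ x) := hGmeas.comp hθ
  have hint : Integrable (fun ω => G (θ (X 0 ω))) μ := by
    refine (hmomX.const_mul (Real.sqrt M * K₂)).mono'
      (hGθm.comp (hmeas 0)).aestronglyMeasurable (ae_of_all _ fun ω => ?_)
    rw [Real.norm_of_nonneg (weightedNorm_nonneg _ _ _)]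
    exact hGθ _
  have hslln := strong_law_ae_real (fun k ω => G (θ (X k ω))) hint
    (fun i j hij => (hindep.indepFun hij).comp hGθm hGθm)
    (fun i => ((hident i).trans (hident 0).symm).comp hGθm)
  have hmean : ∫ ω, G (θ (X 0 ω)) ∂μ = ∫ ω, G (θ (X₀ ω)) ∂μ :=
    ((hident 0).comp hGθm).integral_eq
  change TendstoInMeasure μ
    (fun (n : ℕ) ω => (1 / (n : ℝ)) * ∑ k ∈ Finset.range n, G (T n k ω)) atTop
    (fun _ => ∫ ω, G (θ (X₀ ω)) ∂μ)
  refine (exists_seq_tendstoInMeasure_atTop_iff fun n => ?_).2 fun ns hns => ?_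
  · exact ((Finset.measurable_sum _ fun k _ =>
      hGmeas.comp (hT n k)).const_mul _).aestronglyMeasurable
  obtain ⟨ms, hms, hae⟩ := (havg.comp hns.tendsto_atTop).exists_seq_tendsto_ae
  refine ⟨ms, hms, ?_⟩
  filter_upwards [hae, hslln] with ω h₁ h₂
  rw [hmean] at h₂
  have h₃ := h₁.add (h₂.comp (hns.comp hms).tendsto_atTop)
  rw [zero_add] at h₃
  refine h₃.congr fun i => ?_
  simp only [D, Function.comp_apply, Finset.sum_sub_distrib]
  ring
end
end
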